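/- Let λ ∈ ℂ, R ∈ (0,1], and let (a_n) be a sequence of complex numbers such that the power series g(z) = Σ_{n=0}^∞ a_n z^n converges for |z| < R and g satisfies, for all real z ∈ (0,R), the Heun equation g''(z) + (7/(2z) + λ/(z−1) + 1/(2(z−2))) g'(z) + (1/4)((λ+4)(λ+2)z − (λ²+12λ+12))/(z(z−1)(z−2)) g(z) = 0. Then a₁ = ((λ²+12λ+12)/28) a₀, and for every n ≥ 0, a_{n+2} = A_n(λ) a_{n+1} + B_n(λ) a_n, where A_n(λ) = (12n² + (8λ+56)n + λ² + 20λ + 56)/(8n² + 52n + 72) and B_n(λ) = −(4n² + (4λ+12)n + λ² + 6λ + 8)/(8n² + 52n + 72). -/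

import Mathlib

open Set

/-- The Heun equation in standard form arising from the supersymmetric problem. -/
def HeunEq (l : ℂ) (g : ℝ → ℂ) (z : ℝ) : Prop :=
  deriv (deriv g) z
    + (7 / (2 * (z : ℂ)) + l / ((z : ℂ) - 1) + 1 / (2 * ((z : ℂ) - 2))) * deriv g z
    + (1 / 4) * (((l + 4) * (l + 2) * (z : ℂ) - (l ^ 2 + 12 * l + 12)) /
        ((z : ℂ) * ((z : ℂ) - 1) * ((z : ℂ) - 2))) * g z = 0

/-- The coefficient `A_n(λ)` of the recurrence relation. -/
noncomputable def An (n : ℕ) (l : ℂ) : ℂ :=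
  (12 * (n : ℂ) ^ 2 + (8 * l + 56) * n + l ^ 2 + 20 * l + 56) /
    (8 * (n : ℂ) ^ 2 + 52 * n + 72)

/-- The coefficient `B_n(λ)` of the recurrence relation. -/
noncomputable def Bn (n : ℕ) (l : ℂ) : ℂ :=
  -(4 * (n : ℂ) ^ 2 + (4 * l + 12) * n + l ^ 2 + 6 * l + 8) /
    (8 * (n : ℂ) ^ 2 + 52 * n + 72)

open Filter Topology

/-- The series with coefficients `c n` converges on the open disc of radius `R`. -/
def SummableOnDisc (R : ℝ) (c : ℕ → ℂ) : Prop :=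
  ∀ z : ℂ, ‖z‖ < R → Summable fun n => c n * z ^ n

/-- The coefficients of the derivative of a power series. -/
def derivCoeff (c : ℕ → ℂ) (n : ℕ) : ℂ := (n + 1) * c (n + 1)

/-- The coefficients of `z` times a power series. -/
def shiftCoeff (c : ℕ → ℂ) : ℕ → ℂ
  | 0 => 0
  | n + 1 => c n

theorem hasSum_shiftCoeff {c : ℕ → ℂ} {z S : ℂ} (h : HasSum (fun n => c n * z ^ n) S) :
    HasSum (fun n => shiftCoeff c n * z ^ n) (z * S) := by
  rw [← hasSum_nat_add_iff' 1]
  simpa [shiftCoeff, pow_succ, mul_comm, mul_left_comm, mul_assoc] using h.mul_left z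

theorem SummableOnDisc.derivCoeff_and_hasDerivAt {R : ℝ} {c : ℕ → ℂ} (hc : SummableOnDisc R c)
    {z : ℂ} (hz : ‖z‖ < R) :
    (Summable fun n => derivCoeff c n * z ^ n) ∧
      HasDerivAt (fun w : ℂ => ∑' n, c n * w ^ n) (∑' n, derivCoeff c n * z ^ n) z := by
  obtain ⟨r, hzr, hrR⟩ := exists_between hz
  have hr : 0 ≤ r := (norm_nonneg z).trans hzr.le
  have hu : Summable fun n => ‖c n * (r : ℂ) ^ n‖ :=
    (hc r (by simpa [abs_of_nonneg hr] using hrR)).norm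
  have hd : ∀ n, DifferentiableOn ℂ (fun w : ℂ => c n * w ^ n) (Metric.ball 0 r) :=
    fun n => by fun_prop
  have hle : ∀ n, ∀ w ∈ Metric.ball (0 : ℂ) r, ‖c n * w ^ n‖ ≤ ‖c n * (r : ℂ) ^ n‖ := by
    intro n w hw
    have hw' : ‖w‖ ≤ r := (mem_ball_zero_iff.1 hw).le
    simp only [norm_mul, norm_pow, Complex.norm_real, Real.norm_of_nonneg hr]
    gcongr
  have hzb : z ∈ Metric.ball (0 : ℂ) r := mem_ball_zero_iff.2 hzr
  have hsum := Complex.hasSum_deriv_of_summable_norm hu hd Metric.isOpen_ball hle hzb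
  have hdiff := (Complex.differentiableOn_tsum_of_summable_norm hu hd Metric.isOpen_ball
    hle).differentiableAt (Metric.isOpen_ball.mem_nhds hzb)
  have hsum' : HasSum (fun n => derivCoeff c n * z ^ n)
      (deriv (fun w : ℂ => ∑' n, c n * w ^ n) z) := by
    rw [← hasSum_nat_add_iff' 1] at hsum
    simpa [derivCoeff, mul_comm, mul_left_comm, mul_assoc] using hsum
  exact ⟨hsum'.summable, hsum'.tsum_eq ▸ hdiff.hasDerivAt⟩

theorem SummableOnDisc.derivCoeff {R : ℝ} {c : ℕ → ℂ} (hc : SummableOnDisc R c) :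
    SummableOnDisc R (derivCoeff c) :=
  fun _ hz => (hc.derivCoeff_and_hasDerivAt hz).1

theorem SummableOnDisc.hasDerivAt_ofReal {R : ℝ} {c : ℕ → ℂ} (hc : SummableOnDisc R c)
    {f : ℝ → ℂ} (hf : ∀ x : ℝ, |x| < R → f x = ∑' n, c n * (x : ℂ) ^ n) {x : ℝ} (hx : |x| < R) :
    HasDerivAt f (∑' n, _root_.derivCoeff c n * (x : ℂ) ^ n) x := by
  refine ((hc.derivCoeff_and_hasDerivAt (z := x) (by simpa using hx)).2.comp_ofReal).congr_of_eventuallyEq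
    ?_
  filter_upwards [(isOpen_lt continuous_abs continuous_const).mem_nhds hx] with y hy using hf y hy

/-- A power series vanishing on a right neighbourhood of `0` in `ℝ` has zero coefficients. -/
theorem coeff_eq_zero_of_hasSum {R : ℝ} (hR : 0 < R) {c : ℕ → ℂ} {F : ℂ → ℂ}
    (hF : ∀ z : ℂ, ‖z‖ < R → HasSum (fun n => c n * z ^ n) (F z))
    (h0 : ∀ x ∈ Ioo (0 : ℝ) R, F x = 0) (n : ℕ) : c n = 0 := by
  have hp : HasFPowerSeriesAt F (FormalMultilinearSeries.ofScalars ℂ c) 0 := by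
    rw [hasFPowerSeriesAt_iff]
    filter_upwards [Metric.ball_mem_nhds (0 : ℂ) hR] with z hz
    simpa [mul_comm] using hF z (mem_ball_zero_iff.1 hz)
  have hfreq : ∃ᶠ z in 𝓝[≠] (0 : ℂ), F z = 0 := by
    have ht : Tendsto (fun x : ℝ => (x : ℂ)) (𝓝[>] 0) (𝓝[≠] (0 : ℂ)) := by
      refine tendsto_nhdsWithin_iff.2 ⟨?_, ?_⟩
      · exact (Complex.continuous_ofReal.tendsto' 0 0 (by simp)).mono_left nhdsWithin_le_nhds
      · filter_upwards [self_mem_nhdsWithin] with x hx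
        simpa using (ne_of_gt hx)
    refine ht.frequently (Eventually.frequently ?_)
    filter_upwards [Ioo_mem_nhdsGT hR] with x hx using h0 x hx
  have hev := hp.analyticAt.frequently_zero_iff_eventually_zero.1 hfreq
  have hzero := (hp.congr hev).eq_zero
  rw [← FormalMultilinearSeries.coeff_ofScalars (p := c) (n := n), hzero]
  rfl

theorem heunEq_clear_denominators {l z g₀ g₁ g₂ : ℂ} (h0 : z ≠ 0) (h1 : z - 1 ≠ 0)
    (h2 : z - 2 ≠ 0)
    (h : g₂ + (7 / (2 * z) + l / (z - 1) + 1 / (2 * (z - 2))) * g₁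
      + (1 / 4) * (((l + 4) * (l + 2) * z - (l ^ 2 + 12 * l + 12)) /
        (z * (z - 1) * (z - 2))) * g₀ = 0) :
    4 * (z * (z * (z * g₂))) + -12 * (z * (z * g₂)) + 8 * (z * g₂)
      + (16 + 4 * l) * (z * (z * g₁)) + -(44 + 8 * l) * (z * g₁) + 28 * g₁
      + (l + 4) * (l + 2) * (z * g₀) + -(l ^ 2 + 12 * l + 12) * g₀ = 0 := by
  field_simp at h
  linear_combination h / 2

/-- Power series solutions of the Heun equation have Taylor coefficients
satisfying the recurrence relation. -/
theorem heun_taylor_recurrence (l : ℂ) (R : ℝ) (hR : R ∈ Ioc (0 : ℝ) 1)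
    (a : ℕ → ℂ) (g : ℝ → ℂ)
    (hconv : ∀ z : ℂ, ‖z‖ < R → Summable fun n => a n * z ^ n)
    (hg : ∀ x : ℝ, |x| < R → g x = ∑' n, a n * (x : ℂ) ^ n)
    (heq : ∀ z ∈ Ioo (0 : ℝ) R, HeunEq l g z) :
    a 1 = ((l ^ 2 + 12 * l + 12) / 28) * a 0 ∧
      ∀ n : ℕ, a (n + 2) = An n l * a (n + 1) + Bn n l * a n := by
  have ha : SummableOnDisc R a := hconv
  have hb := ha.derivCoeff
  have hd := hb.derivCoeff
  have hg' : ∀ x : ℝ, |x| < R → deriv g x = ∑' n, derivCoeff a n * (x : ℂ) ^ n :=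
    fun x hx => (ha.hasDerivAt_ofReal hg hx).deriv
  have hg'' : ∀ x : ℝ, |x| < R →
      deriv (deriv g) x = ∑' n, derivCoeff (derivCoeff a) n * (x : ℂ) ^ n :=
    fun x hx => (hb.hasDerivAt_ofReal hg' hx).deriv
  have hsum : ∀ z : ℂ, ‖z‖ < R → HasSum _ _ := fun z hz =>
    have h0 := (ha z hz).hasSum
    have h1 := (hb z hz).hasSum
    have h2 := (hd z hz).hasSum
    have h1s := hasSum_shiftCoeff h1
    have h2s := hasSum_shiftCoeff h2
    have h2ss := hasSum_shiftCoeff h2s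
    ((((((((hasSum_shiftCoeff h2ss).mul_left 4).add (h2ss.mul_left (-12))).add
      (h2s.mul_left 8)).add ((hasSum_shiftCoeff h1s).mul_left (16 + 4 * l))).add
      (h1s.mul_left (-(44 + 8 * l)))).add (h1.mul_left 28)).add
      ((hasSum_shiftCoeff h0).mul_left ((l + 4) * (l + 2)))).add
      (h0.mul_left (-(l ^ 2 + 12 * l + 12)))
  simp only [← mul_assoc, ← add_mul] at hsum
  have hcoeff := coeff_eq_zero_of_hasSum hR.1 hsum fun x hx => by
    have hxR : |x| < R := by rw [abs_of_pos hx.1]; exact hx.2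
    have hx1 : x < 1 := hx.2.trans_le hR.2
    have h := heq x hx
    rw [HeunEq, hg x hxR, hg' x hxR, hg'' x hxR] at h
    have := heunEq_clear_denominators (by exact_mod_cast hx.1.ne')
      (by exact_mod_cast (sub_neg.2 hx1).ne)
      (by exact_mod_cast (sub_neg.2 (hx1.trans one_lt_two)).ne) h
    linear_combination this
  refine ⟨?_, fun n => ?_⟩
  · have h := hcoeff 0
    simp only [shiftCoeff, derivCoeff] at h
    push_cast at h
    linear_combination h / 28
  · have hden : (8 * (n : ℂ) ^ 2 + 52 * n + 72) ≠ 0 := by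
      exact_mod_cast (by positivity : 8 * n ^ 2 + 52 * n + 72 ≠ 0)
    have h := hcoeff (n + 1)
    rw [An, Bn, div_mul_eq_mul_div, div_mul_eq_mul_div, ← add_div, eq_div_iff hden]
    rcases n with _ | _ | n <;> simp only [shiftCoeff, derivCoeff] at h <;> push_cast at h ⊢ <;>
      linear_combination h
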